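/- There is a universal constant C > 0 such that for every ε > 0, β ∈ (0,1), and integers d, T ≥ 1, there exists an ε-differentially private (event level) continual-observation mechanism M with input universe {0,1}^d, output space ℝ and stream length T such that for every input stream x, with M(x)-probability at least 1 − β, the output sequence (a^1,…,a^T) satisfies |a^t − Q_{1/2}(h^t(x))| ≤ C · ε^{-1} · ( d·log²(d·n_median(x)/β) + log T ) for all t ≤ T, where n_median(x) = Q_{1/2}(h^T(x)) is the median column sum of x (the Quantile_{1/2} problem under continual observation). -/

import Mathlib

open MeasureTheory

/-- Base-2 logarithm where the argument is clamped below by 2. -/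
noncomputable def log2c (z : ℝ) : ℝ := Real.logb 2 (max z 2)

/-- The histogram of a stream of rows from `{0,1}^d` at time step `t`:
the `i`-th column sum of the first `t+1` rows (time steps are 0-indexed). -/
def hist {d T : ℕ} (x : Fin T → Fin d → Bool) (t : Fin T) (i : Fin d) : ℕ :=
  ∑ s : Fin T, if s ≤ t ∧ x s i then 1 else 0

/-- Two streams differ in at most one time step (event-level neighboring). -/
def EventNeighboring {X : Type*} {T : ℕ} (x y : Fin T → X) : Prop :=
  ∃ t₀ : Fin T, ∀ s : Fin T, s ≠ t₀ → x s = y s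

/-- A continual-observation mechanism: a measurable assignment of output
distributions to input streams whose outputs up to time `t` depend only on the
first `t` inputs. -/
def IsCOMech {X O : Type*} [MeasurableSpace X] [MeasurableSpace O] {T : ℕ}
    (M : (Fin T → X) → Measure (Fin T → O)) : Prop :=
  Measurable M ∧ (∀ x, IsProbabilityMeasure (M x)) ∧
    ∀ (t : Fin T) (x y : Fin T → X), (∀ s, s ≤ t → x s = y s) →
      (M x).map (fun a (s : {s : Fin T // s ≤ t}) => a s.1) =
      (M y).map (fun a (s : {s : Fin T // s ≤ t}) => a s.1)

/-- `ε`-differential privacy (event level) for a continual-observation mechanism. -/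
def IsEventDP {X O : Type*} [MeasurableSpace X] [MeasurableSpace O] {T : ℕ} (ε : ℝ)
    (M : (Fin T → X) → Measure (Fin T → O)) : Prop :=
  ∀ x y, EventNeighboring x y → ∀ S : Set (Fin T → O), MeasurableSet S →
    M x S ≤ ENNReal.ofReal (Real.exp ε) * M y S

/-- The last (0-indexed) time step of a stream of length `T ≥ 1`. -/
def lastIdx (T : ℕ) (hT : 1 ≤ T) : Fin T := ⟨T - 1, Nat.sub_lt hT Nat.one_pos⟩

/-- The `p`-quantile of a vector `c ∈ ℝ^d`: the smallest value `c j` such that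
at least `p·d` of the coordinates of `c` are `≤ c j`. -/
noncomputable def quantile {d : ℕ} (p : ℝ) (c : Fin d → ℝ) : ℝ :=
  sInf {z : ℝ | ∃ j : Fin d, z = c j ∧ p * d ≤ ({i : Fin d | c i ≤ c j}.ncard : ℝ)}


/-! ### Quantiles -/

theorem quantile_mem {d : ℕ} (hd : 1 ≤ d) (c : Fin d → ℝ) :
    ∃ j : Fin d, quantile (1/2) c = c j ∧ (1/2 : ℝ) * d ≤ ({i : Fin d | c i ≤ c j}.ncard : ℝ) := by
  have hne : ({z : ℝ | ∃ j : Fin d, z = c j ∧ (1/2:ℝ) * d ≤ ({i : Fin d | c i ≤ c j}.ncard : ℝ)}).Nonempty := by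
    have : Nonempty (Fin d) := ⟨⟨0, hd⟩⟩
    obtain ⟨j, hj⟩ := Finite.exists_max c
    refine ⟨c j, j, rfl, ?_⟩
    have : {i : Fin d | c i ≤ c j} = Set.univ := by
      ext i; simp [hj i]
    rw [this, Set.ncard_univ, Nat.card_eq_fintype_card, Fintype.card_fin]
    have : (0:ℝ) ≤ d := Nat.cast_nonneg d
    linarith
  have hfin : ({z : ℝ | ∃ j : Fin d, z = c j ∧ (1/2:ℝ) * d ≤ ({i : Fin d | c i ≤ c j}.ncard : ℝ)}).Finite := by
    refine (Set.finite_range c).subset ?_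
    rintro z ⟨j, rfl, _⟩
    exact ⟨j, rfl⟩
  obtain ⟨j, h1, h2⟩ := hne.csInf_mem hfin
  exact ⟨j, h1, h2⟩

theorem quantile_le_iff {d : ℕ} (hd : 1 ≤ d) (c : Fin d → ℝ) (z : ℝ) :
    quantile (1/2) c ≤ z ↔ (1/2 : ℝ) * d ≤ ({i : Fin d | c i ≤ z}.ncard : ℝ) := by
  constructor
  · intro h
    obtain ⟨j, h1, h2⟩ := quantile_mem hd c
    refine h2.trans ?_
    have : {i : Fin d | c i ≤ c j} ⊆ {i : Fin d | c i ≤ z} := by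
      intro i hi
      simp only [Set.mem_ofPred_eq] at hi ⊢
      linarith
    exact_mod_cast Set.ncard_le_ncard this (Set.toFinite _)
  · intro h
    have hpos : (0:ℝ) < ({i : Fin d | c i ≤ z}.ncard : ℝ) := by
      have : (1:ℝ) ≤ d := by exact_mod_cast hd
      linarith
    have hne : ({i : Fin d | c i ≤ z}).Nonempty := by
      rw [← Set.ncard_pos (Set.toFinite _)]
      exact_mod_cast hpos
    obtain ⟨j, hj, hmax⟩ := Set.exists_max_image _ c (Set.toFinite {i : Fin d | c i ≤ z}) hne
    have hbdd : BddBelow ({z : ℝ | ∃ j : Fin d, z = c j ∧ (1/2:ℝ) * d ≤ ({i : Fin d | c i ≤ c j}.ncard : ℝ)}) := by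
      refine ((Set.finite_range c).subset ?_).bddBelow
      rintro z ⟨j, rfl, _⟩
      exact ⟨j, rfl⟩
    refine (csInf_le hbdd ⟨j, rfl, h.trans ?_⟩).trans hj
    have : {i : Fin d | c i ≤ z} ⊆ {i : Fin d | c i ≤ c j} := fun i hi => hmax i hi
    exact_mod_cast Set.ncard_le_ncard this (Set.toFinite _)

theorem quantile_le_add {d : ℕ} (hd : 1 ≤ d) (c c' : Fin d → ℝ) (g : ℝ)
    (h : ∀ i, c i ≤ c' i + g) : quantile (1/2) c ≤ quantile (1/2) c' + g := by
  rw [quantile_le_iff hd]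
  refine ((quantile_le_iff hd c' _).1 le_rfl).trans ?_
  have : {i : Fin d | c' i ≤ quantile (1/2) c'} ⊆ {i : Fin d | c i ≤ quantile (1/2) c' + g} := by
    intro i hi
    simp only [Set.mem_ofPred_eq] at hi ⊢
    linarith [h i]
  exact_mod_cast Set.ncard_le_ncard this (Set.toFinite _)

/-- quantile of an integer vector -/
noncomputable def qz {d : ℕ} (c : Fin d → ℤ) : ℝ := quantile (1/2) (fun i => (c i : ℝ))

theorem qz_int {d : ℕ} (hd : 1 ≤ d) (c : Fin d → ℤ) : ∃ k : ℤ, qz c = k := by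
  obtain ⟨j, h, _⟩ := quantile_mem hd (fun i => (c i : ℝ))
  exact ⟨c j, h⟩

theorem qz_le_add {d : ℕ} (hd : 1 ≤ d) (c c' : Fin d → ℤ) (g : ℝ)
    (h : ∀ i, (c i : ℝ) ≤ c' i + g) : qz c ≤ qz c' + g :=
  quantile_le_add hd _ _ g h

/-! ### The tree structure -/

def par (j : ℕ) : ℕ :=
  if j ≤ 2 then j - 1 else if j % 2 = 1 then j - 1 else 2 * par (j / 2)
termination_by j
decreasing_by omega

theorem par_lt (j : ℕ) (hj : 1 ≤ j) : par j < j := by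
  induction j using Nat.strong_induction_on with
  | _ j ih =>
    rw [par]
    split_ifs with h1 h2
    · omega
    · omega
    · have := ih (j/2) (by omega) (by omega)
      omega

theorem par_pos (j : ℕ) (hj : 2 ≤ j) : 1 ≤ par j := by
  induction j using Nat.strong_induction_on with
  | _ j ih =>
    rw [par]
    split_ifs with h1 h2
    · omega
    · omega
    · have := ih (j/2) (by omega) (by omega)
      omega

theorem par_two_mul (k : ℕ) (hk : 2 ≤ k) : par (2 * k) = 2 * par k := by
  rw [par, if_neg (by omega), if_neg (by omega)]
  congr 2; omega

theorem par_odd (k : ℕ) (hk : 1 ≤ k) : par (2 * k + 1) = 2 * k := by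
  rw [par, if_neg (by omega), if_pos (by omega)]; omega

def chain (j : ℕ) : Finset ℕ :=
  if _h : j = 0 then ∅ else insert j (chain (par j))
termination_by j
decreasing_by exact par_lt j (by omega)

theorem chain_zero : chain 0 = ∅ := by rw [chain]; simp

theorem chain_pos (j : ℕ) (hj : 1 ≤ j) : chain j = insert j (chain (par j)) := by
  rw [chain, dif_neg (by omega)]

theorem chain_le (j : ℕ) : ∀ v ∈ chain j, 1 ≤ v ∧ v ≤ j := by
  induction j using Nat.strong_induction_on with
  | _ j ih =>
    intro v hv
    rcases Nat.eq_zero_or_pos j with h | h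
    · subst h; simp [chain_zero] at hv
    · rw [chain_pos j h, Finset.mem_insert] at hv
      have := par_lt j h
      rcases hv with hv | hv
      · omega
      · have := ih _ this v hv
        omega

theorem chain_pos_notMem (j : ℕ) (hj : 1 ≤ j) : j ∉ chain (par j) := by
  intro h
  have := (chain_le _ j h).2
  have := par_lt j hj
  omega

theorem chain_card_pos (j : ℕ) (hj : 1 ≤ j) : (chain j).card = (chain (par j)).card + 1 := by
  rw [chain_pos j hj, Finset.card_insert_of_notMem (chain_pos_notMem j hj)]

theorem chain_card_two_mul (k : ℕ) (hk : 1 ≤ k) : (chain (2 * k)).card = (chain k).card + 1 := by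
  induction k using Nat.strong_induction_on with
  | _ k ih =>
    rcases Nat.lt_or_ge k 2 with h | h
    · have : k = 1 := by omega
      subst this
      rw [chain_card_pos 2 (by omega)]
      have : par 2 = 1 := by rw [par]; simp
      rw [this]
    · rw [chain_card_pos (2*k) (by omega), par_two_mul k h, ih _ (par_lt k hk) (par_pos k h),
        chain_card_pos k hk]

theorem chain_card_le (j : ℕ) (hj : 1 ≤ j) : (chain j).card ≤ 2 * Nat.log 2 j + 1 := by
  induction j using Nat.strong_induction_on with
  | _ j ih =>
    rcases Nat.lt_or_ge j 2 with h | h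
    · have : j = 1 := by omega
      subst this
      rw [chain_card_pos 1 (by omega)]
      have : par 1 = 0 := by rw [par]; simp
      rw [this, chain_zero]; simp
    · have hl : Nat.log 2 j = Nat.log 2 (j/2) + 1 := Nat.log_of_one_lt_of_le (by norm_num) h
      have hi := ih (j/2) (by omega) (by omega)
      rcases Nat.even_or_odd' j with ⟨k, hk | hk⟩
      · have e : j / 2 = k := by omega
        rw [hl, e]; rw [e] at hi
        rw [hk, chain_card_two_mul k (by omega)]
        omega
      · have e : j / 2 = k := by omega
        rw [hl, e]; rw [e] at hi
        rw [hk, chain_card_pos _ (by omega), par_odd k (by omega), chain_card_two_mul k (by omega)]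
        omega

theorem chain_card_le' (j : ℕ) : (chain j).card ≤ 2 * (Nat.clog 2 j + 1) := by
  rcases Nat.eq_zero_or_pos j with h | h
  · subst h; simp [chain_zero]
  · have := chain_card_le j h
    have := Nat.log_le_clog 2 j
    omega

def covF (i : ℕ) : Finset ℕ :=
  if i ≤ 1 then {1} else insert i ((covF ((i+1)/2)).image (2 * ·))
termination_by i
decreasing_by omega

theorem covF_card (i : ℕ) : (covF i).card ≤ Nat.clog 2 i + 1 := by
  induction i using Nat.strong_induction_on with
  | _ i ih =>
    rw [covF]
    split_ifs with h
    · simp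
    · refine (Finset.card_insert_le _ _).trans ?_
      have h1 := ih ((i+1)/2) (by omega)
      have h2 := Finset.card_image_le (s := covF ((i+1)/2)) (f := (2 * ·))
      have h3 := Nat.clog_of_two_le (b := 2) (n := i) (by norm_num) (by omega)
      have h4 : (i + 2 - 1)/2 = (i+1)/2 := by omega
      rw [h4] at h3
      omega

theorem mem_covF (i : ℕ) (hi : 1 ≤ i) : ∀ v, par v < i → i ≤ v → v ∈ covF i := by
  induction i using Nat.strong_induction_on with
  | _ i ih =>
    intro v h1 h2
    rw [covF]
    split_ifs with h
    · have : i = 1 := by omega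
      subst this
      have : ¬ 2 ≤ v := fun hv => by have := par_pos v hv; omega
      simp; omega
    · rw [Finset.mem_insert, Finset.mem_image]
      rcases Nat.even_or_odd' v with ⟨k, hk | hk⟩
      · right
        refine ⟨k, ?_, hk.symm⟩
        rcases Nat.lt_or_ge k 2 with hk2 | hk2
        · have h1k : k = 1 := by omega
          have : i = 2 := by omega
          subst h1k; subst this
          exact ih _ (by omega) (by omega) 1 (by rw [par]; simp) (by omega)
        · rw [hk, par_two_mul k hk2] at h1
          exact ih _ (by omega) (by omega) k (by omega) (by omega)
      · left
        rcases Nat.eq_zero_or_pos k with h0 | h0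
        · omega
        · rw [hk, par_odd k h0] at h1
          omega

theorem chain_sum_shift (i : ℕ) (hi : 1 ≤ i) (D : ℤ) (J : ℕ) :
    ∑ v ∈ chain J, (if par v < i ∧ i ≤ v then D else 0) = if i ≤ J then D else 0 := by
  induction J using Nat.strong_induction_on with
  | _ J ih =>
    rcases Nat.eq_zero_or_pos J with h | h
    · subst h; rw [chain_zero, if_neg (by omega)]; simp
    · rw [chain_pos J h, Finset.sum_insert (chain_pos_notMem J h), ih _ (par_lt J h)]
      have := par_lt J h
      split_ifs <;> omega

/-! ### The trajectory -/

open Classical in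
noncomputable def traj {d : ℕ} (L : ℕ → ℝ) (H N : ℕ → Fin d → ℤ) (mu nu : ℕ → ℤ) : ℕ → ℕ
  | 0 => 0
  | t + 1 =>
    if L (traj L H N mu nu t) + mu (traj L H N mu nu t) <
      qz (fun i => H t i + N (traj L H N mu nu t) i) + nu t
    then traj L H N mu nu t + 1 else traj L H N mu nu t

theorem traj_le {d : ℕ} (L : ℕ → ℝ) (H N : ℕ → Fin d → ℤ) (mu nu : ℕ → ℤ) (t : ℕ) :
    traj L H N mu nu t ≤ t := by
  induction t with
  | zero => simp [traj]
  | succ t ih => rw [traj]; split_ifs <;> omega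

theorem traj_mono {d : ℕ} (L : ℕ → ℝ) (H N : ℕ → Fin d → ℤ) (mu nu : ℕ → ℤ) :
    Monotone (traj L H N mu nu) := by
  refine monotone_nat_of_le_succ fun t => ?_
  rw [traj]; split_ifs <;> omega

theorem traj_congr {d : ℕ} (L : ℕ → ℝ) (H H' N : ℕ → Fin d → ℤ) (mu nu : ℕ → ℤ) (t : ℕ)
    (h : ∀ s < t, H s = H' s) : traj L H N mu nu t = traj L H' N mu nu t := by
  induction t with
  | zero => rfl
  | succ t ih =>
    rw [traj, traj, ih (fun s hs => h s (by omega)), h t (by omega)]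

theorem traj_couple {d : ℕ} (hd : 1 ≤ d) (T : ℕ) (L : ℕ → ℝ) (H H' N N' : ℕ → Fin d → ℤ)
    (mu nu mu' nu' : ℕ → ℤ) (t0 : ℕ) (D : Fin d → ℤ) (hD : ∀ i, |D i| ≤ 1)
    (J : ℕ → ℕ) (hJ : J = traj L H N mu nu)
    (hH : ∀ t < T, ∀ i, H' t i = H t i + if t0 ≤ t then D i else 0)
    (hN : ∀ j < T, ∀ i, N' j i = N j i + if J t0 + 1 ≤ j then - D i else 0)
    (hmu : ∀ j < T, mu' j = mu j + if j = J t0 then 1 else 0)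
    (hnu : ∀ t < T, nu' t = nu t + if J t = J t0 ∧ J (t+1) = J t0 + 1 then 2 else 0) :
    ∀ t ≤ T, traj L H' N' mu' nu' t = J t := by
  intro t
  induction t with
  | zero => intro _; rw [hJ]; rfl
  | succ t ih =>
    intro ht
    have ih := ih (by omega)
    have hmono : Monotone J := hJ ▸ traj_mono L H N mu nu
    have hle : J t < T := by
      have := traj_le L H N mu nu t
      rw [← hJ] at this; omega
    have hstep : J (t+1) = if L (J t) + mu (J t) < qz (fun i => H t i + N (J t) i) + nu t
        then J t + 1 else J t := by
      conv_lhs => rw [hJ, traj]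
      rw [← hJ]
    rw [traj, ih]
    have e1 : qz (fun i => H' t i + N' (J t) i) ≤ qz (fun i => H t i + N (J t) i) + 1 := by
      refine qz_le_add hd _ _ _ fun i => ?_
      have h1 := hH t (by omega) i
      have h2 := hN (J t) hle i
      have h3 := abs_le.1 (hD i)
      have : H' t i + N' (J t) i ≤ H t i + N (J t) i + 1 := by
        rw [h1, h2]; split_ifs <;> omega
      exact_mod_cast this
    have e2 : qz (fun i => H t i + N (J t) i) ≤ qz (fun i => H' t i + N' (J t) i) + 1 := by
      refine qz_le_add hd _ _ _ fun i => ?_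
      have h1 := hH t (by omega) i
      have h2 := hN (J t) hle i
      have h3 := abs_le.1 (hD i)
      have : H t i + N (J t) i ≤ H' t i + N' (J t) i + 1 := by
        rw [h1, h2]; split_ifs <;> omega
      exact_mod_cast this
    by_cases hc : J t = J t0
    · have m1 : (mu' (J t) : ℝ) = mu (J t) + 1 := by
        rw [hmu _ hle, if_pos hc]; push_cast; ring
      by_cases hx : L (J t) + mu (J t) < qz (fun i => H t i + N (J t) i) + nu t
      · rw [if_pos hx] at hstep
        have n1 : (nu' t : ℝ) = nu t + 2 := by
          rw [hnu t (by omega), if_pos ⟨hc, by omega⟩]; push_cast; ring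
        rw [if_pos (by rw [m1, n1]; linarith), hstep]
      · rw [if_neg hx] at hstep
        have n1 : (nu' t : ℝ) = nu t := by
          rw [hnu t (by omega), if_neg (by omega)]; push_cast; ring
        rw [if_neg (by rw [m1, n1]; push Not at hx ⊢; linarith), hstep]
    · have m1 : mu' (J t) = mu (J t) := by
        rw [hmu _ hle, if_neg hc]; ring
      have n1 : nu' t = nu t := by
        rw [hnu t (by omega), if_neg (by tauto)]; ring
      have q1 : (fun i => H' t i + N' (J t) i) = (fun i => H t i + N (J t) i) := by
        funext i
        rw [hH t (by omega) i, hN _ hle i]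
        rcases lt_or_ge t t0 with h | h
        · have := hmono h.le
          rw [if_neg (by omega), if_neg (by omega)]; ring
        · have := hmono h
          rw [if_pos h, if_pos (by omega)]; ring
      rw [m1, n1, q1, hstep]

theorem traj_accurate {d : ℕ} (hd : 1 ≤ d) (T : ℕ) (L G : ℕ → ℝ) (H N : ℕ → Fin d → ℤ)
    (mu nu : ℕ → ℤ) (hG : Monotone G) (hG0 : 0 ≤ G 0) (hL : ∀ j, L j = j + G j)
    (h0 : ∀ i, H 0 i ≤ 1) (hn : ∀ i, 0 ≤ H 0 i)
    (hmono : ∀ t i, H t i ≤ H (t+1) i) (hinc : ∀ t i, H (t+1) i ≤ H t i + 1)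
    (herr : ∀ t < T, ∀ j < T, |qz (fun i => H t i + N j i) + nu t - mu j - qz (H t)| ≤ G j) :
    ∀ t < T, (traj L H N mu nu (t+1) : ℝ) ≤ qz (H t) ∧
      qz (H t) ≤ traj L H N mu nu (t+1) + 2 * G (traj L H N mu nu (t+1)) := by
  have hz : qz (fun _ : Fin d => (0:ℤ)) = 0 := by
    obtain ⟨j, h, _⟩ := quantile_mem hd (fun _ : Fin d => ((0:ℤ) : ℝ))
    simpa [qz] using h
  -- step lemma
  have key : ∀ t < T, ∀ m : ℝ, (traj L H N mu nu t : ℝ) ≤ m →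
      m ≤ traj L H N mu nu t + 2 * G (traj L H N mu nu t) → m ≤ qz (H t) → qz (H t) ≤ m + 1 →
      (traj L H N mu nu (t+1) : ℝ) ≤ qz (H t) ∧
      qz (H t) ≤ traj L H N mu nu (t+1) + 2 * G (traj L H N mu nu (t+1)) := by
    intro t ht m h1 h2 h3 h4
    have hle := traj_le L H N mu nu t
    rw [traj]
    generalize traj L H N mu nu t = J at *
    have he := abs_le.1 (herr t ht J (by omega))
    have hLJ := hL J
    split_ifs with hc
    · have hlt : (J : ℝ) < qz (H t) := by linarith
      obtain ⟨k, hk⟩ := qz_int hd (H t)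
      have hGG := hG (Nat.le_succ J)
      simp only [Nat.succ_eq_add_one] at hGG
      rw [hk] at hlt
      have : (J : ℤ) < k := by exact_mod_cast hlt
      have h5 : ((J : ℤ) + 1 : ℤ) ≤ k := by omega
      have h6 : (J : ℝ) + 1 ≤ k := by exact_mod_cast h5
      refine ⟨by push_cast; linarith, by push_cast; linarith⟩
    · push Not at hc
      exact ⟨by linarith, by linarith⟩
  intro t
  induction t with
  | zero =>
    intro ht
    refine key 0 ht 0 (by simp [traj]) (by simp [traj]; linarith) ?_ ?_
    · have := qz_le_add hd (fun _ => 0) (H 0) 0 (fun i => by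
        have := hn i
        push_cast; rw [add_zero]; exact_mod_cast this)
      linarith
    · have := qz_le_add hd (H 0) (fun _ => 0) 1 (fun i => by
        have := h0 i
        push_cast; rw [zero_add]; exact_mod_cast this)
      linarith
  | succ t ih =>
    intro ht
    obtain ⟨a, b⟩ := ih (by omega)
    refine key (t+1) ht (qz (H t)) a b ?_ ?_
    · have := qz_le_add hd (H t) (H (t+1)) 0 (fun i => by
        rw [add_zero]; exact_mod_cast hmono t i)
      linarith
    · exact qz_le_add hd (H (t+1)) (H t) 1 (fun i => by exact_mod_cast hinc t i)

/-! ### Two-sided geometric noise -/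

theorem hasSum_abs_pow (s : ℝ) (h0 : 0 ≤ s) (h1 : s < 1) :
    HasSum (fun k : ℤ => s ^ k.natAbs) ((1 + s) / (1 - s)) := by
  have g := hasSum_geometric_of_lt_one h0 h1
  have e : (1 + s) / (1 - s) = (1 - s)⁻¹ + s * (1 - s)⁻¹ := by
    rw [div_eq_mul_inv]; ring
  rw [e]
  refine HasSum.of_nat_of_neg_add_one ?_ ?_
  · simpa using g
  · have : (fun n : ℕ => s ^ (-((n : ℤ) + 1)).natAbs) = fun n : ℕ => s * s ^ n := by
      funext n
      have : (-((n : ℤ) + 1)).natAbs = n + 1 := by omega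
      rw [this, pow_succ]; ring
    rw [this]
    exact g.mul_left s

noncomputable def gw (l : ℝ) (k : ℤ) : ℝ :=
  (1 - Real.exp (-l)) / (1 + Real.exp (-l)) * Real.exp (-l) ^ k.natAbs

noncomputable def geo (l : ℝ) : Measure ℤ :=
  Measure.count.withDensity (fun k => ENNReal.ofReal (gw l k))

theorem geo_singleton (l : ℝ) (k : ℤ) : geo l {k} = ENNReal.ofReal (gw l k) := by
  rw [geo, withDensity_apply _ (measurableSet_singleton k), lintegral_singleton]
  simp

theorem gw_nonneg (l : ℝ) (hl : 0 < l) (k : ℤ) : 0 ≤ gw l k := by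
  have : Real.exp (-l) < 1 := by rw [Real.exp_lt_one_iff]; linarith
  have := Real.exp_pos (-l)
  unfold gw
  have : 0 ≤ 1 - Real.exp (-l) := by linarith
  positivity

theorem geo_prob (l : ℝ) (hl : 0 < l) : IsProbabilityMeasure (geo l) := by
  constructor
  have h1 : Real.exp (-l) < 1 := by rw [Real.exp_lt_one_iff]; linarith
  have h0 := Real.exp_pos (-l)
  have hs := (hasSum_abs_pow _ h0.le h1).mul_left ((1 - Real.exp (-l)) / (1 + Real.exp (-l)))
  rw [geo, withDensity_apply _ MeasurableSet.univ, Measure.restrict_univ, lintegral_count]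
  rw [← ENNReal.ofReal_tsum_of_nonneg (gw_nonneg l hl) hs.summable]
  have : ∑' k, gw l k = 1 := by
    rw [show ∑' k, gw l k = _ from hs.tsum_eq]
    have : 1 - Real.exp (-l) ≠ 0 := by linarith
    field_simp
  rw [this]; simp

theorem gw_shift (l : ℝ) (hl : 0 < l) (k D : ℤ) :
    gw l k ≤ Real.exp (l * |(D : ℝ)|) * gw l (k + D) := by
  have h1 : Real.exp (-l) < 1 := by rw [Real.exp_lt_one_iff]; linarith
  have h0 := Real.exp_pos (-l)
  unfold gw
  have e : Real.exp (l * |(D : ℝ)|) * (Real.exp (-l)) ^ D.natAbs = 1 := by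
    rw [← Real.exp_nat_mul, ← Real.exp_add]
    have : (D.natAbs : ℝ) = |(D : ℝ)| := by
      rw [Nat.cast_natAbs]; simp
    rw [this]; simp; ring
  have key : Real.exp (-l) ^ k.natAbs ≤ Real.exp (l * |(D : ℝ)|) * Real.exp (-l) ^ (k + D).natAbs := by
    calc Real.exp (-l) ^ k.natAbs
        = Real.exp (l * |(D : ℝ)|) * (Real.exp (-l)) ^ (k.natAbs + D.natAbs) := by
          rw [pow_add, mul_left_comm, e, mul_one]
      _ ≤ _ := by
          refine mul_le_mul_of_nonneg_left ?_ (Real.exp_pos _).le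
          exact pow_le_pow_of_le_one h0.le h1.le (Int.natAbs_add_le k D)
  have : 0 ≤ (1 - Real.exp (-l)) / (1 + Real.exp (-l)) := by
    have : 0 ≤ 1 - Real.exp (-l) := by linarith
    positivity
  calc _ ≤ (1 - Real.exp (-l)) / (1 + Real.exp (-l)) *
      (Real.exp (l * |(D : ℝ)|) * Real.exp (-l) ^ (k + D).natAbs) :=
        mul_le_mul_of_nonneg_left key this
    _ = _ := by ring

theorem geo_mgf (l θ : ℝ) (hl : 0 < l) (hθ : θ ≤ l / 2) :
    ∫⁻ k, ENNReal.ofReal (Real.exp (θ * |(k : ℝ)|)) ∂(geo l) ≤ 2 := by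
  set s := Real.exp (-(l/2)) with hs
  have hs0 : 0 < s := Real.exp_pos _
  have hs1 : s < 1 := by rw [hs, Real.exp_lt_one_iff]; linarith
  have hr : Real.exp (-l) = s * s := by rw [hs, ← Real.exp_add]; congr 1; ring
  have hS := (hasSum_abs_pow s hs0.le hs1).mul_left ((1 - s * s) / (1 + s * s))
  have hc : 0 ≤ (1 - s * s) / (1 + s * s) := by
    have : 0 ≤ 1 - s * s := by nlinarith
    positivity
  rw [lintegral_countable']
  calc ∑' k : ℤ, ENNReal.ofReal (Real.exp (θ * |(k : ℝ)|)) * geo l {k}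
      ≤ ∑' k : ℤ, ENNReal.ofReal ((1 - s * s) / (1 + s * s) * s ^ k.natAbs) := by
        refine ENNReal.tsum_le_tsum fun k => ?_
        rw [geo_singleton, ← ENNReal.ofReal_mul (Real.exp_pos _).le]
        refine ENNReal.ofReal_le_ofReal ?_
        unfold gw
        rw [hr]
        have e : Real.exp (θ * |(k : ℝ)|) * s ^ k.natAbs ≤ 1 := by
          rw [hs, ← Real.exp_nat_mul, ← Real.exp_add, Real.exp_le_one_iff]
          have : (k.natAbs : ℝ) = |(k : ℝ)| := by
            rw [Nat.cast_natAbs]; simp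
          rw [this]
          nlinarith [abs_nonneg (k : ℝ)]
        calc Real.exp (θ * |(k : ℝ)|) * ((1 - s * s) / (1 + s * s) * (s * s) ^ k.natAbs)
            = (Real.exp (θ * |(k : ℝ)|) * s ^ k.natAbs) * ((1 - s * s) / (1 + s * s) * s ^ k.natAbs) := by
              rw [mul_pow]; ring
          _ ≤ 1 * ((1 - s * s) / (1 + s * s) * s ^ k.natAbs) :=
              mul_le_mul_of_nonneg_right e (by positivity)
          _ = _ := one_mul _
    _ = ENNReal.ofReal ((1 - s * s) / (1 + s * s) * ((1 + s) / (1 - s))) := by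
        rw [← ENNReal.ofReal_tsum_of_nonneg (fun k => by positivity) hS.summable, hS.tsum_eq]
    _ ≤ ENNReal.ofReal 2 := by
        refine ENNReal.ofReal_le_ofReal ?_
        have : 0 < 1 - s := by linarith
        rw [div_mul_div_comm, div_le_iff₀ (by positivity)]
        nlinarith [mul_pos this hs0, sq_nonneg (1 - s), mul_nonneg this.le (sq_nonneg (1-s))]
    _ = 2 := by simp

theorem pi_tail {ι : Type*} [Fintype ι] (l : ι → ℝ) (hl : ∀ k, 0 < l k) (s : Finset ι)
    (θ g p : ℝ) (hθ : ∀ k ∈ s, θ ≤ l k / 2) (m : ℕ) (hm : s.card ≤ m)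
    (hp0 : 0 < p) (hp : m * Real.log 2 + Real.log (1 / p) ≤ θ * g) (hθ0 : 0 ≤ θ) :
    (Measure.pi fun k => geo (l k)) {z | g < ∑ k ∈ s, |(z k : ℝ)|} ≤ ENNReal.ofReal p := by
  have : ∀ k, IsProbabilityMeasure (geo (l k)) := fun k => geo_prob _ (hl k)
  set P := Measure.pi fun k => geo (l k)
  set F : (ι → ℤ) → ENNReal := fun z => ∏ k ∈ s, ENNReal.ofReal (Real.exp (θ * |(z k : ℝ)|)) with hF
  have hFi : ∫⁻ z, F z ∂P ≤ 2 ^ m := by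
    have hind := ProbabilityTheory.iIndepFun_pi (μ := fun k => geo (l k))
      (X := fun _ (n : ℤ) => ENNReal.ofReal (Real.exp (θ * |(n : ℝ)|)))
      (fun k => (measurable_of_countable _).aemeasurable)
    have := ProbabilityTheory.lintegral_prod_eq_prod_lintegral_of_indepFun s _ hind
      (fun k => measurable_of_countable _)
    rw [hF, this]
    calc _ ≤ ∏ k ∈ s, (2 : ENNReal) := by
          refine Finset.prod_le_prod' fun k hk => ?_
          have e := (measurePreserving_eval (fun k => geo (l k)) k).lintegral_comp
            (f := fun n : ℤ => ENNReal.ofReal (Real.exp (θ * |(n : ℝ)|))) (measurable_of_countable _)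
          refine le_trans (le_of_eq ?_) (geo_mgf (l k) θ (hl k) (hθ k hk))
          exact e
      _ = 2 ^ s.card := by simp
      _ ≤ 2 ^ m := pow_le_pow_right₀ (by norm_num) hm
  have hmark := mul_meas_ge_le_lintegral (μ := P) (f := F) (measurable_of_countable _)
    (ENNReal.ofReal (Real.exp (θ * g)))
  have hsub : {z : ι → ℤ | g < ∑ k ∈ s, |(z k : ℝ)|} ⊆ {z | ENNReal.ofReal (Real.exp (θ * g)) ≤ F z} := by
    intro z hz
    simp only [Set.mem_ofPred_eq] at hz ⊢
    rw [hF]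
    simp only
    rw [← ENNReal.ofReal_prod_of_nonneg (fun _ _ => (Real.exp_pos _).le), ← Real.exp_sum,
      ← Finset.mul_sum]
    exact ENNReal.ofReal_le_ofReal (Real.exp_le_exp.2 (mul_le_mul_of_nonneg_left hz.le hθ0))
  have h2 : (2 : ENNReal) ^ m ≤ ENNReal.ofReal (Real.exp (θ * g)) * ENNReal.ofReal p := by
    rw [← ENNReal.ofReal_mul (Real.exp_pos _).le]
    have : (2 : ENNReal) ^ m = ENNReal.ofReal (2 ^ m) := by
      rw [ENNReal.ofReal_pow (by norm_num)]; simp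
    rw [this]
    refine ENNReal.ofReal_le_ofReal ?_
    rw [one_div, Real.log_inv] at hp
    have h3 : Real.exp (m * Real.log 2 - Real.log p) ≤ Real.exp (θ * g) :=
      Real.exp_le_exp.2 (by linarith)
    rw [Real.exp_sub, Real.exp_log hp0, Real.exp_nat_mul, Real.exp_log (by norm_num),
      div_le_iff₀ hp0] at h3
    exact h3
  have hE0 : ENNReal.ofReal (Real.exp (θ * g)) ≠ 0 := by
    simp [Real.exp_pos]
  have h4 := (mul_le_mul_right (measure_mono hsub) (ENNReal.ofReal (Real.exp (θ * g)))).trans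
    (hmark.trans (hFi.trans h2))
  exact (ENNReal.mul_le_mul_iff_right hE0 ENNReal.ofReal_ne_top).1 h4

theorem pi_shift {ι : Type*} [Fintype ι] (l : ι → ℝ) (hl : ∀ k, 0 < l k) (D : (ι → ℤ) → ι → ℤ)
    (e : ℝ) (hD : ∀ z, ∑ k, l k * |(D z k : ℝ)| ≤ e)
    (hinj : Function.Injective (fun z => z + D z)) (A B : Set (ι → ℤ))
    (hAB : ∀ z ∈ A, z + D z ∈ B) :
    (Measure.pi fun k => geo (l k)) A ≤
      ENNReal.ofReal (Real.exp e) * (Measure.pi fun k => geo (l k)) B := by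
  have : ∀ k, IsProbabilityMeasure (geo (l k)) := fun k => geo_prob _ (hl k)
  have hms : ∀ S : Set (ι → ℤ), (Measure.pi fun k => geo (l k)) S
      = ∑' z, S.indicator (fun z => (Measure.pi fun k => geo (l k)) {z}) z := by
    intro S
    rw [← lintegral_indicator_one (Set.to_countable S).measurableSet, lintegral_countable']
    refine tsum_congr fun z => ?_
    by_cases hz : z ∈ S <;> simp [hz]
  rw [hms A, hms B, ← ENNReal.tsum_mul_left]
  refine le_trans ?_ (ENNReal.tsum_comp_le_tsum_of_injective hinj _)
  refine ENNReal.tsum_le_tsum fun z => ?_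
  by_cases hz : z ∈ A
  · rw [Set.indicator_of_mem hz, Set.indicator_of_mem (hAB z hz), Measure.pi_singleton,
      Measure.pi_singleton]
    simp only [geo_singleton]
    rw [← ENNReal.ofReal_prod_of_nonneg (fun k _ => gw_nonneg _ (hl k) _),
      ← ENNReal.ofReal_prod_of_nonneg (fun k _ => gw_nonneg _ (hl k) _),
      ← ENNReal.ofReal_mul (Real.exp_pos _).le]
    refine ENNReal.ofReal_le_ofReal ?_
    calc ∏ k, gw (l k) (z k)
        ≤ ∏ k, (Real.exp (l k * |(D z k : ℝ)|) * gw (l k) (z k + D z k)) :=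
          Finset.prod_le_prod (fun k _ => gw_nonneg _ (hl k) _) fun k _ => gw_shift _ (hl k) _ _
      _ = Real.exp (∑ k, l k * |(D z k : ℝ)|) * ∏ k, gw (l k) (z k + D z k) := by
          rw [Finset.prod_mul_distrib, Real.exp_sum]
      _ ≤ Real.exp e * ∏ k, gw (l k) (z k + D z k) :=
          mul_le_mul_of_nonneg_right (Real.exp_le_exp.2 (hD z))
            (Finset.prod_nonneg fun k _ => gw_nonneg _ (hl k) _)
      _ = _ := rfl
  · rw [Set.indicator_of_notMem hz]; exact zero_le

/-! ### The mechanism -/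

abbrev Idx (d T : ℕ) := (Fin (T + 1) × Fin d) ⊕ (Fin (T + 1) ⊕ Fin T)

noncomputable def rate (ε : ℝ) (d T : ℕ) : Idx d T → ℝ
  | Sum.inl (v, _) => ε / (3 * d * ((Nat.clog 2 v.val : ℝ) + 1))
  | Sum.inr (Sum.inl _) => ε / 3
  | Sum.inr (Sum.inr _) => ε / 6

def zN {d T : ℕ} (z : Idx d T → ℤ) (J : ℕ) (i : Fin d) : ℤ :=
  ∑ v ∈ chain J, if h : v < T + 1 then z (Sum.inl (⟨v, h⟩, i)) else 0

def zmu {d T : ℕ} (z : Idx d T → ℤ) (J : ℕ) : ℤ :=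
  if h : J < T + 1 then z (Sum.inr (Sum.inl ⟨J, h⟩)) else 0

def znu {d T : ℕ} (z : Idx d T → ℤ) (t : ℕ) : ℤ :=
  if h : t < T then z (Sum.inr (Sum.inr ⟨t, h⟩)) else 0

def HH {d T : ℕ} (x : Fin T → Fin d → Bool) (t : ℕ) (i : Fin d) : ℤ :=
  ∑ s : Fin T, if s.val ≤ t ∧ x s i then 1 else 0

noncomputable def out {d T : ℕ} (L : ℕ → ℝ) (x : Fin T → Fin d → Bool) (z : Idx d T → ℤ) : ℕ → ℕ :=
  traj L (HH x) (zN z) (zmu z) (znu z)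

theorem rate_pos (ε : ℝ) (d T : ℕ) (hε : 0 < ε) (hd : 1 ≤ d) (k : Idx d T) : 0 < rate ε d T k := by
  have : (0:ℝ) < d := by exact_mod_cast hd
  rcases k with ⟨v, i⟩ | j | t <;> simp only [rate] <;> positivity

def shf {d T : ℕ} (D : Fin d → ℤ) (t0 : ℕ) (J : ℕ → ℕ) : Idx d T → ℤ
  | Sum.inl (v, i) => if par v.val < J t0 + 1 ∧ J t0 + 1 ≤ v.val then - D i else 0
  | Sum.inr (Sum.inl j) => if j.val = J t0 then 1 else 0
  | Sum.inr (Sum.inr t) => if J t.val = J t0 ∧ J (t.val + 1) = J t0 + 1 then 2 else 0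

theorem shf_cost {d T : ℕ} (ε : ℝ) (hε : 0 < ε) (hd : 1 ≤ d) (D : Fin d → ℤ) (hD : ∀ i, |D i| ≤ 1)
    (t0 : ℕ) (J : ℕ → ℕ) (hJ : Monotone J) :
    ∑ k, rate ε d T k * |((shf D t0 J k : ℤ) : ℝ)| ≤ ε := by
  have hd' : (0:ℝ) < d := by exact_mod_cast hd
  rw [Fintype.sum_sum_type, Fintype.sum_sum_type, Fintype.sum_prod_type]
  have h1 : ∑ v : Fin (T+1), ∑ i : Fin d, rate ε d T (Sum.inl (v, i)) *
      |((shf D t0 J (Sum.inl (v, i) : Idx d T) : ℤ) : ℝ)| ≤ ε / 3 := by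
    set i0 := J t0 + 1 with hi0
    set c : ℝ := (Nat.clog 2 i0 : ℝ) + 1 with hc
    have hcpos : 0 < c := by positivity
    calc _ ≤ ∑ v : Fin (T+1), (if par v.val < i0 ∧ i0 ≤ v.val then ε / (3 * c) else 0) := by
          refine Finset.sum_le_sum fun v _ => ?_
          split_ifs with h
          · calc _ ≤ ∑ i : Fin d, ε / (3 * d * c) := by
                  refine Finset.sum_le_sum fun i _ => ?_
                  simp only [rate, shf]
                  rw [if_pos h]
                  have a1 : |(((-D i : ℤ)) : ℝ)| ≤ 1 := by
                    have := hD i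
                    rw [← abs_neg] at this
                    exact_mod_cast this
                  have a2 : c ≤ (Nat.clog 2 v.val : ℝ) + 1 := by
                    rw [hc]
                    have := Nat.clog_mono_right 2 h.2
                    have : (Nat.clog 2 i0 : ℝ) ≤ Nat.clog 2 v.val := by exact_mod_cast this
                    linarith
                  calc _ ≤ ε / (3 * d * ((Nat.clog 2 v.val : ℝ) + 1)) * 1 := by gcongr
                    _ ≤ ε / (3 * d * c) := by rw [mul_one]; gcongr
              _ = ε / (3 * c) := by
                  simp only [Finset.sum_const, Finset.card_univ, Fintype.card_fin, nsmul_eq_mul]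
                  field_simp
          · refine le_of_eq (Finset.sum_eq_zero fun i _ => ?_)
            simp only [shf]
            rw [if_neg h]; simp
      _ = ((Finset.univ.filter fun v : Fin (T+1) => par v.val < i0 ∧ i0 ≤ v.val).card : ℝ) *
            (ε / (3 * c)) := by
          rw [← Finset.sum_filter]; simp
      _ ≤ c * (ε / (3 * c)) := by
          refine mul_le_mul_of_nonneg_right ?_ (by positivity)
          have a : (Finset.univ.filter fun v : Fin (T+1) => par v.val < i0 ∧ i0 ≤ v.val).card
              ≤ (covF i0).card := by
            refine Finset.card_le_card_of_injOn (fun v => v.val) ?_ ?_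
            · intro v hv
              simp only [Finset.coe_filter, Finset.mem_univ, true_and, Set.mem_ofPred_eq] at hv
              exact mem_covF i0 (by omega) _ hv.1 hv.2
            · intro a _ b _ h
              exact Fin.ext h
          have := a.trans (covF_card i0)
          rw [hc]
          exact_mod_cast this
      _ = ε / 3 := by field_simp
  have h2 : ∑ j : Fin (T+1), rate ε d T (Sum.inr (Sum.inl j)) *
      |((shf D t0 J (Sum.inr (Sum.inl j) : Idx d T) : ℤ) : ℝ)| ≤ ε / 3 := by
    calc _ = ∑ j : Fin (T+1), (if j.val = J t0 then ε / 3 else 0) := by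
          refine Finset.sum_congr rfl fun j _ => ?_
          simp only [rate, shf]
          split_ifs <;> simp
      _ = ((Finset.univ.filter fun j : Fin (T+1) => j.val = J t0).card : ℝ) * (ε / 3) := by
          rw [← Finset.sum_filter]; simp
      _ ≤ 1 * (ε / 3) := by
          refine mul_le_mul_of_nonneg_right ?_ (by positivity)
          have : (Finset.univ.filter fun j : Fin (T+1) => j.val = J t0).card ≤ 1 := by
            refine Finset.card_le_one.2 fun a ha b hb => ?_
            simp only [Finset.mem_filter, Finset.mem_univ, true_and] at ha hb
            exact Fin.ext (by omega)
          exact_mod_cast this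
      _ = _ := one_mul _
  have h3 : ∑ t : Fin T, rate ε d T (Sum.inr (Sum.inr t)) *
      |((shf D t0 J (Sum.inr (Sum.inr t) : Idx d T) : ℤ) : ℝ)| ≤ ε / 3 := by
    calc _ = ∑ t : Fin T, (if J t.val = J t0 ∧ J (t.val + 1) = J t0 + 1 then ε / 3 else 0) := by
          refine Finset.sum_congr rfl fun j _ => ?_
          simp only [rate, shf]
          split_ifs
          · norm_num; ring
          · simp
      _ = ((Finset.univ.filter fun t : Fin T => J t.val = J t0 ∧ J (t.val + 1) = J t0 + 1).card : ℝ)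
            * (ε / 3) := by
          rw [← Finset.sum_filter]; simp
      _ ≤ 1 * (ε / 3) := by
          refine mul_le_mul_of_nonneg_right ?_ (by positivity)
          have : (Finset.univ.filter fun t : Fin T =>
              J t.val = J t0 ∧ J (t.val + 1) = J t0 + 1).card ≤ 1 := by
            refine Finset.card_le_one.2 fun a ha b hb => ?_
            simp only [Finset.mem_filter, Finset.mem_univ, true_and] at ha hb
            refine Fin.ext ?_
            by_contra hne
            rcases Nat.lt_or_gt_of_ne hne with h | h
            · have := hJ (show a.val + 1 ≤ b.val from h)
              omega
            · have := hJ (show b.val + 1 ≤ a.val from h)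
              omega
          exact_mod_cast this
      _ = _ := one_mul _
  linarith

theorem out_couple {d T : ℕ} (hd : 1 ≤ d) (L : ℕ → ℝ) (x y : Fin T → Fin d → Bool)
    (t0 : Fin T) (D : Fin d → ℤ) (hD : ∀ i, |D i| ≤ 1)
    (hH : ∀ t i, HH y t i = HH x t i + if t0.val ≤ t then D i else 0) (z : Idx d T → ℤ) :
    ∀ t ≤ T, out L y (z + shf D t0 (out L x z)) t = out L x z t := by
  refine traj_couple hd T L (HH x) (HH y) (zN z) _ (zmu z) (znu z) _ _ t0 D hD (out L x z) rfl
    (fun t _ i => hH t i) ?_ ?_ ?_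
  · intro j hj i
    rw [← chain_sum_shift (out L x z t0 + 1) (by omega) (- D i) j]
    unfold zN
    rw [← Finset.sum_add_distrib]
    refine Finset.sum_congr rfl fun v hv => ?_
    have : v < T + 1 := by have := (chain_le j v hv).2; omega
    rw [dif_pos this, dif_pos this]
    rfl
  · intro j hj
    unfold zmu
    have : j < T + 1 := by omega
    rw [dif_pos this, dif_pos this]
    rfl
  · intro t ht
    unfold znu
    rw [dif_pos ht, dif_pos ht]
    rfl

theorem HH_neighbor {d T : ℕ} (x y : Fin T → Fin d → Bool) (t0 : Fin T)
    (h : ∀ s, s ≠ t0 → x s = y s) (t : ℕ) (i : Fin d) :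
    HH y t i = HH x t i +
      if t0.val ≤ t then ((if y t0 i then 1 else 0) - (if x t0 i then 1 else 0) : ℤ) else 0 := by
  unfold HH
  rw [← Finset.add_sum_erase _ _ (Finset.mem_univ t0),
    ← Finset.add_sum_erase (f := fun s : Fin T => if s.val ≤ t ∧ x s i then (1:ℤ) else 0) _
      (Finset.mem_univ t0)]
  have : ∑ s ∈ Finset.univ.erase t0, (if s.val ≤ t ∧ y s i then (1:ℤ) else 0)
      = ∑ s ∈ Finset.univ.erase t0, (if s.val ≤ t ∧ x s i then (1:ℤ) else 0) := by
    refine Finset.sum_congr rfl fun s hs => ?_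
    rw [h s (Finset.ne_of_mem_erase hs)]
  rw [this]
  by_cases ht : t0.val ≤ t <;> simp [ht]
  ring

noncomputable def noise (ε : ℝ) (d T : ℕ) : Measure (Idx d T → ℤ) :=
  Measure.pi fun k => geo (rate ε d T k)

noncomputable def mech (ε : ℝ) (d T : ℕ) (L : ℕ → ℝ) (x : Fin T → Fin d → Bool) :
    Measure (Fin T → ℝ) :=
  (noise ε d T).map (fun z (t : Fin T) => (out L x z (t.val + 1) : ℝ))

theorem noise_prob (ε : ℝ) (d T : ℕ) (hε : 0 < ε) (hd : 1 ≤ d) :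
    IsProbabilityMeasure (noise ε d T) := by
  have : ∀ k, IsProbabilityMeasure (geo (rate ε d T k)) :=
    fun k => geo_prob _ (rate_pos ε d T hε hd k)
  unfold noise
  infer_instance

theorem HH_congr {d T : ℕ} (x y : Fin T → Fin d → Bool) (t : ℕ)
    (h : ∀ s : Fin T, s.val ≤ t → x s = y s) : HH x t = HH y t := by
  funext i
  unfold HH
  refine Finset.sum_congr rfl fun s _ => ?_
  by_cases hs : s.val ≤ t
  · rw [h s hs]
  · simp [hs]

theorem mech_isCO (ε : ℝ) (d T : ℕ) (L : ℕ → ℝ) (hε : 0 < ε) (hd : 1 ≤ d) :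
    IsCOMech (mech ε d T L) := by
  have hP := noise_prob ε d T hε hd
  refine ⟨measurable_of_finite _, fun x => ?_, fun t x y hxy => ?_⟩
  · exact Measure.isProbabilityMeasure_map (measurable_of_countable _).aemeasurable
  · unfold mech
    have hm : Measurable (fun (a : Fin T → ℝ) (s : {s : Fin T // s ≤ t}) => a s.1) := by fun_prop
    rw [Measure.map_map hm (measurable_of_countable _), Measure.map_map hm (measurable_of_countable _)]
    congr 1
    funext z s
    simp only [Function.comp]
    unfold out
    rw [traj_congr L (HH x) (HH y)]
    intro r hr
    refine HH_congr x y r fun s' hs' => hxy s' ?_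
    have := s.2
    rw [Fin.le_def] at this ⊢
    omega

theorem mech_dp (ε : ℝ) (d T : ℕ) (L : ℕ → ℝ) (hε : 0 < ε) (hd : 1 ≤ d) :
    IsEventDP ε (mech ε d T L) := by
  rintro x y ⟨t0, h⟩ S hS
  set D : Fin d → ℤ := fun i => ((if y t0 i then 1 else 0) - (if x t0 i then 1 else 0) : ℤ) with hDdef
  have hD : ∀ i, |D i| ≤ 1 := by
    intro i
    simp only [hDdef]
    split_ifs <;> simp
  have hc := out_couple hd L x y t0 D hD (HH_neighbor x y t0 h)
  unfold mech
  rw [Measure.map_apply (measurable_of_countable _) hS, Measure.map_apply (measurable_of_countable _) hS]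
  refine pi_shift (rate ε d T) (rate_pos ε d T hε hd) (fun z => shf D t0 (out L x z)) ε
    (fun z => shf_cost ε hε hd D hD t0 _ (traj_mono _ _ _ _ _)) ?_ _ _ ?_
  · intro z z' hzz
    simp only at hzz
    have hJ : ∀ t ≤ T, out L x z t = out L x z' t := by
      intro t ht
      rw [← hc z t ht, ← hc z' t ht, hzz]
    have hs : (shf D t0 (out L x z) : Idx d T → ℤ) = shf D t0 (out L x z') := by
      have h0 := hJ t0.val t0.2.le
      funext k
      rcases k with ⟨v, i⟩ | j | t
      · simp only [shf, h0]
      · simp only [shf, h0]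
      · simp only [shf, h0, hJ t.val t.2.le, hJ (t.val + 1) t.2]
    rw [hs] at hzz
    exact add_right_cancel hzz
  · intro z hz
    have e : (fun t : Fin T => (out L y (z + shf D t0 (out L x z)) (t.val + 1) : ℝ)) =
        fun t : Fin T => (out L x z (t.val + 1) : ℝ) := by
      funext t
      rw [hc z _ t.2]
    rw [Set.mem_preimage] at hz ⊢
    rw [e]
    exact hz

/-! ### Accuracy -/

noncomputable def g1 (ε β : ℝ) (d J : ℕ) : ℝ :=
  6 * d * ((Nat.clog 2 J : ℝ) + 1) / ε *
    (2 * ((Nat.clog 2 J : ℝ) + 1) * Real.log 2 + Real.log (3 * d * ((J + 1) * (J + 2)) / β))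

noncomputable def g2 (ε β : ℝ) (J : ℕ) : ℝ :=
  6 / ε * (Real.log 2 + Real.log (3 * ((J + 1) * (J + 2)) / β))

noncomputable def g3 (ε β : ℝ) (T : ℕ) : ℝ :=
  12 / ε * (Real.log 2 + Real.log (3 * T / β))

noncomputable def GG (ε β : ℝ) (d T J : ℕ) : ℝ := g1 ε β d J + g2 ε β J + g3 ε β T

theorem log_arg_one (a β : ℝ) (ha : 1 ≤ a) (h0 : 0 < β) (h1 : β < 1) : 0 ≤ Real.log (a / β) := by
  refine Real.log_nonneg ?_
  rw [le_div_iff₀ h0]; linarith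

theorem GG_mono (ε β : ℝ) (d T : ℕ) (hε : 0 < ε) (h0 : 0 < β) (h1 : β < 1) (hd : 1 ≤ d) :
    Monotone (GG ε β d T) := by
  intro a b hab
  have hd' : (1:ℝ) ≤ d := by exact_mod_cast hd
  have hab' : (a:ℝ) ≤ b := by exact_mod_cast hab
  have hc : (Nat.clog 2 a : ℝ) ≤ Nat.clog 2 b := by exact_mod_cast Nat.clog_mono_right 2 hab
  have hl := Real.log_pos (show (1:ℝ) < 2 by norm_num)
  have ha0 : (0:ℝ) ≤ a := Nat.cast_nonneg a
  have hbig : (1:ℝ) ≤ 3 * d * ((a + 1) * (a + 2)) := by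
    have : (1:ℝ) ≤ (a + 1) * (a + 2) := by nlinarith
    nlinarith
  have hn := log_arg_one _ β hbig h0 h1
  unfold GG g1 g2
  gcongr

theorem GG_parts_nonneg (ε β : ℝ) (d T : ℕ) (hε : 0 < ε) (h0 : 0 < β) (h1 : β < 1) (hd : 1 ≤ d)
    (hT : 1 ≤ T) (J : ℕ) : 0 ≤ g1 ε β d J ∧ 0 ≤ g2 ε β J ∧ 0 ≤ g3 ε β T := by
  have hd' : (1:ℝ) ≤ d := by exact_mod_cast hd
  have hT' : (1:ℝ) ≤ T := by exact_mod_cast hT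
  have hl := Real.log_pos (show (1:ℝ) < 2 by norm_num)
  have ha0 : (0:ℝ) ≤ J := Nat.cast_nonneg J
  have hb : (1:ℝ) ≤ 3 * ((J + 1) * (J + 2)) := by nlinarith
  have hbig : (1:ℝ) ≤ 3 * d * ((J + 1) * (J + 2)) := by
    have : (1:ℝ) ≤ (J + 1) * (J + 2) := by nlinarith
    nlinarith
  have hn := log_arg_one _ β hbig h0 h1
  have hn2 := log_arg_one _ β hb h0 h1
  have hn3 := log_arg_one (3 * T) β (by linarith) h0 h1
  unfold g1 g2 g3
  refine ⟨by positivity, by positivity, by positivity⟩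

theorem GG_bound (ε β : ℝ) (d T : ℕ) (hε : 0 < ε) (h0 : 0 < β) (h1 : β < 1) (hd : 1 ≤ d)
    (hT : 1 ≤ T) (n : ℕ) (hn : 1 ≤ n) :
    2 * GG ε β d T n ≤ 600 * ε⁻¹ * ((d:ℝ) * (log2c ((d:ℝ) * n / β)) ^ 2 + log2c T) := by
  have hd' : (1:ℝ) ≤ d := by exact_mod_cast hd
  have hT' : (1:ℝ) ≤ T := by exact_mod_cast hT
  have hn' : (1:ℝ) ≤ n := by exact_mod_cast hn
  have hl2 : 0 < Real.log 2 := Real.log_pos (by norm_num)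
  have hl2' : Real.log 2 ≤ 1 := by have := Real.log_two_lt_d9; linarith
  set l := log2c ((d:ℝ) * n / β) with hl
  have hl1 : 1 ≤ l := by
    rw [hl, log2c, Real.le_logb_iff_rpow_le (by norm_num) (by positivity)]
    simp
  have hLT : 0 ≤ log2c T := by
    rw [log2c]; exact Real.logb_nonneg (by norm_num) (by
      exact le_trans (by norm_num) (le_max_right _ _))
  -- natural log versus log2c
  have hlog : ∀ w : ℝ, 1 ≤ w → Real.log w ≤ log2c w := by
    intro w hw
    rw [log2c]
    have a1 : Real.logb 2 w ≤ Real.logb 2 (max w 2) :=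
      Real.logb_le_logb_of_le (by norm_num) (by linarith) (le_max_left _ _)
    refine le_trans ?_ a1
    rw [Real.logb, le_div_iff₀ hl2]
    nlinarith [Real.log_nonneg hw]
  have hz1 : (1:ℝ) ≤ (d:ℝ) * n / β := by
    rw [le_div_iff₀ h0]; nlinarith
  have hz : Real.log ((d:ℝ) * n / β) ≤ l := hlog _ hz1
  have hzn : (n:ℝ) ≤ (d:ℝ) * n / β := by
    rw [le_div_iff₀ h0]; nlinarith
  have hzb : 1 / β ≤ (d:ℝ) * n / β := by
    gcongr; nlinarith
  -- clog bound
  have hc : (Nat.clog 2 n : ℝ) + 1 ≤ 3 * l := by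
    rcases Nat.lt_or_ge 1 n with h | h
    · have h2 := Nat.pow_pred_clog_lt_self (b := 2) (by norm_num) h
      have hcl : 0 < Nat.clog 2 n := Nat.clog_pos (by norm_num) h
      have h3 : (2:ℝ) ^ ((Nat.clog 2 n).pred) ≤ n := by exact_mod_cast h2.le
      have h4 : ((Nat.clog 2 n).pred : ℝ) ≤ l := by
        rw [hl, log2c, Real.le_logb_iff_rpow_le (by norm_num) (by positivity), Real.rpow_natCast]
        exact h3.trans (hzn.trans (le_max_left _ _))
      have h5 : (Nat.clog 2 n : ℝ) = ((Nat.clog 2 n).pred : ℝ) + 1 := by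
        have : Nat.clog 2 n = (Nat.clog 2 n).pred + 1 := (Nat.succ_pred_eq_of_pos hcl).symm
        exact_mod_cast this
      linarith
    · have : n = 1 := by omega
      subst this; simp; linarith
  have hlog18 : Real.log 18 ≤ 3 := by
    have : Real.log 18 ≤ Real.log (2 ^ 4 * 2) := Real.log_le_log (by norm_num) (by norm_num)
    rw [← pow_succ, Real.log_pow] at this
    have := Real.log_two_lt_d9
    have h5 : Real.log 18 ≤ Real.log (Real.exp 1 ^ 3) := by
      refine Real.log_le_log (by norm_num) ?_
      have := Real.exp_one_gt_d9
      calc (18:ℝ) ≤ 2.7 ^ 3 := by norm_num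
        _ ≤ _ := by gcongr; linarith
    rw [Real.log_pow, Real.log_exp] at h5
    norm_num at h5; exact h5
  have hq : (d:ℝ) * ((n + 1) * (n + 2)) / β ≤ 6 * (((d:ℝ) * n / β) * ((d:ℝ) * n / β)) := by
    have e : 6 * (((d:ℝ) * n / β) * ((d:ℝ) * n / β)) = (6 * (d * n / β) * (d * n)) / β := by
      field_simp
    rw [e]
    refine div_le_div_of_nonneg_right ?_ h0.le
    have : (d:ℝ) * ((n + 1) * (n + 2)) ≤ 6 * n * (d * n) := by
      have : ((n:ℝ) + 1) * (n + 2) ≤ 6 * n * n := by nlinarith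
      nlinarith
    refine this.trans ?_
    gcongr
  have hA : Real.log (3 * d * ((n + 1) * (n + 2)) / β) ≤ 5 * l := by
    have hzpos : 0 < (d:ℝ) * n / β := by linarith
    calc _ ≤ Real.log (18 * (((d:ℝ) * n / β) * ((d:ℝ) * n / β))) := by
          refine Real.log_le_log (by positivity) ?_
          have : 3 * (d:ℝ) * ((n + 1) * (n + 2)) / β = 3 * (d * ((n + 1) * (n + 2)) / β) := by ring
          rw [this]; linarith
      _ = Real.log 18 + (Real.log ((d:ℝ) * n / β) + Real.log ((d:ℝ) * n / β)) := by
          rw [Real.log_mul (by norm_num) (by positivity), Real.log_mul (by positivity) (by positivity)]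
      _ ≤ 5 * l := by linarith
  have hB : Real.log (3 * ((n + 1) * (n + 2)) / β) ≤ 5 * l := by
    refine le_trans (Real.log_le_log (by positivity) ?_) hA
    gcongr
    nlinarith
  have hCc : Real.log (3 * T / β) ≤ 4 * l + log2c T := by
    have e : (3:ℝ) * T / β = 3 * (T * (1 / β)) := by ring
    rw [e, Real.log_mul (by norm_num) (by positivity), Real.log_mul (by positivity) (by positivity)]
    have a1 := hlog T hT'
    have a2 : Real.log (1/β) ≤ l := (Real.log_le_log (by positivity) hzb).trans hz
    have a3 : Real.log 3 ≤ Real.log 18 := Real.log_le_log (by norm_num) (by norm_num)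
    linarith
  have hll : l ≤ d * l ^ 2 := by nlinarith
  have b1 : g1 ε β d n ≤ 198 * ε⁻¹ * (d * l ^ 2) := by
    unfold g1
    have hcn : 0 ≤ (Nat.clog 2 n : ℝ) := Nat.cast_nonneg _
    have hn0 : 0 ≤ Real.log (3 * d * ((n + 1) * (n + 2)) / β) := by
      refine log_arg_one _ β ?_ h0 h1
      have : (1:ℝ) ≤ (n + 1) * (n + 2) := by nlinarith
      nlinarith
    calc _ ≤ 6 * d * (3 * l) / ε * (2 * (3 * l) * 1 + 5 * l) := by
          gcongr
      _ = _ := by field_simp; ring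
  have b2 : g2 ε β n ≤ 36 * ε⁻¹ * (d * l ^ 2) := by
    unfold g2
    calc _ ≤ 6 / ε * (l + 5 * l) := by gcongr; linarith
      _ = 36 * ε⁻¹ * l := by field_simp; ring
      _ ≤ _ := by gcongr
  have b3 : g3 ε β T ≤ 60 * ε⁻¹ * (d * l ^ 2) + 12 * ε⁻¹ * log2c T := by
    unfold g3
    calc _ ≤ 12 / ε * (l + (4 * l + log2c T)) := by gcongr; linarith
      _ = 60 * ε⁻¹ * l + 12 * ε⁻¹ * log2c T := by field_simp; ring
      _ ≤ _ := by gcongr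
  unfold GG
  have c1 : 0 ≤ ε⁻¹ * (d * l ^ 2) := by positivity
  have c2 : 0 ≤ ε⁻¹ * log2c T := by positivity
  nlinarith

theorem sum_tele (T : ℕ) : ∑ J : Fin T, (1:ℝ) / (((J.val:ℝ) + 1) * (J.val + 2)) ≤ 1 := by
  rw [Fin.sum_univ_eq_sum_range (fun J : ℕ => (1:ℝ) / (((J:ℝ) + 1) * (J + 2)))]
  have : ∑ J ∈ Finset.range T, (1:ℝ) / (((J:ℝ) + 1) * (J + 2)) = 1 - 1 / (T + 1) := by
    induction T with
    | zero => simp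
    | succ n ih =>
      rw [Finset.sum_range_succ, ih]
      push_cast
      field_simp
      ring
  rw [this]
  have : (0:ℝ) ≤ 1 / (T + 1) := by positivity
  linarith

/-- indices of the nodes involved in the prefix noise `zN z J i` -/
def nodes (d T J : ℕ) (i : Fin d) : Finset (Idx d T) :=
  (Finset.univ.filter fun v : Fin (T+1) => v.val ∈ chain J).image fun v => Sum.inl (v, i)

theorem nodes_card (d T J : ℕ) (i : Fin d) : (nodes d T J i).card ≤ 2 * (Nat.clog 2 J + 1) := by
  refine Finset.card_image_le.trans (le_trans ?_ (chain_card_le' J))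
  refine Finset.card_le_card_of_injOn (fun v => v.val) ?_ ?_
  · intro v hv
    simpa using hv
  · intro a _ b _ h
    exact Fin.ext h

theorem zN_le {d T : ℕ} (z : Idx d T → ℤ) (J : ℕ) (hJ : J < T + 1) (i : Fin d) :
    |(zN z J i : ℝ)| ≤ ∑ k ∈ nodes d T J i, |(z k : ℝ)| := by
  unfold zN nodes
  rw [Finset.sum_image (by
    intro a _ b _ h
    simpa using h)]
  push_cast
  refine (Finset.abs_sum_le_sum_abs _ _).trans (le_of_eq ?_)
  symm
  refine Finset.sum_bij (fun v _ => v.val) ?_ ?_ ?_ ?_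
  · intro v hv
    simpa using hv
  · intro a _ b _ h
    exact Fin.ext h
  · intro v hv
    have := (chain_le J v hv).2
    exact ⟨⟨v, by omega⟩, by simpa using hv, rfl⟩
  · intro v hv
    rw [dif_pos v.2]

def Good (ε β : ℝ) (d T : ℕ) (z : Idx d T → ℤ) : Prop :=
  (∀ (J : Fin (T+1)) (i : Fin d), ∑ k ∈ nodes d T J i, |(z k : ℝ)| ≤ g1 ε β d J) ∧
  (∀ J : Fin (T+1), |(z (Sum.inr (Sum.inl J)) : ℝ)| ≤ g2 ε β J) ∧
  (∀ t : Fin T, |(z (Sum.inr (Sum.inr t)) : ℝ)| ≤ g3 ε β T)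

theorem good_prob (ε β : ℝ) (d T : ℕ) (hε : 0 < ε) (h0 : 0 < β) (h1 : β < 1) (hd : 1 ≤ d)
    (hT : 1 ≤ T) : ENNReal.ofReal (1 - β) ≤ noise ε d T {z | Good ε β d T z} := by
  have hP := noise_prob ε d T hε hd
  have hd' : (0:ℝ) < d := by exact_mod_cast hd
  have hT' : (0:ℝ) < T := by exact_mod_cast hT
  set w : Fin (T+1) → ℝ := fun J => 1 / (((J.val:ℝ) + 1) * (J.val + 2)) with hw
  have hwpos : ∀ J, 0 < w J := fun J => by rw [hw]; positivity
  have hwsum : ∑ J, w J ≤ 1 := sum_tele (T+1)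
  have t1 : ∀ (J : Fin (T+1)) (i : Fin d),
      noise ε d T {z | g1 ε β d J < ∑ k ∈ nodes d T J i, |(z k : ℝ)|}
        ≤ ENNReal.ofReal (β / (3 * d) * w J) := by
    intro J i
    set c : ℝ := (Nat.clog 2 J.val : ℝ) + 1 with hc
    have hcpos : 0 < c := by positivity
    refine pi_tail (rate ε d T) (rate_pos ε d T hε hd) (nodes d T J i) (ε / (6 * d * c)) _ _ ?_
      (2 * (Nat.clog 2 J.val + 1)) (nodes_card d T J i) ?_ ?_ ?_
    · intro k hk
      simp only [nodes, Finset.mem_image, Finset.mem_filter, Finset.mem_univ, true_and] at hk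
      obtain ⟨v, hv, rfl⟩ := hk
      have hvJ := (chain_le _ _ hv).2
      have hcl : (Nat.clog 2 v.val : ℝ) ≤ Nat.clog 2 J.val := by
        exact_mod_cast Nat.clog_mono_right 2 hvJ
      simp only [rate]
      rw [div_div]
      refine div_le_div_of_nonneg_left hε.le (by positivity) ?_
      calc _ = 6 * d * ((Nat.clog 2 v.val : ℝ) + 1) := by ring
        _ ≤ _ := by rw [hc]; gcongr
    · have := hwpos J; positivity
    · refine le_of_eq ?_
      unfold g1
      rw [← hc]
      have e : 1 / (β / (3 * d) * w J) = 3 * d * ((J.val + 1) * (J.val + 2)) / β := by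
        simp only [hw]; field_simp
      rw [e]
      push_cast
      rw [← hc]
      field_simp
    · positivity
  have t2 : ∀ J : Fin (T+1), noise ε d T {z | g2 ε β J < |(z (Sum.inr (Sum.inl J)) : ℝ)|}
        ≤ ENNReal.ofReal (β / 3 * w J) := by
    intro J
    have := pi_tail (rate ε d T) (rate_pos ε d T hε hd) {Sum.inr (Sum.inl J)} (ε / 6)
      (g2 ε β J) (β / 3 * w J) (by
        intro k hk
        rw [Finset.mem_singleton] at hk
        subst hk
        simp only [rate]; linarith) 1 (by simp) (by have := hwpos J; positivity) (by
        refine le_of_eq ?_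
        unfold g2
        have e : 1 / (β / 3 * w J) = 3 * ((J.val + 1) * (J.val + 2)) / β := by
          simp only [hw]; field_simp
        rw [e]
        field_simp
        simp) (by positivity)
    simpa [noise] using this
  have t3 : ∀ t : Fin T, noise ε d T {z | g3 ε β T < |(z (Sum.inr (Sum.inr t)) : ℝ)|}
        ≤ ENNReal.ofReal (β / (3 * T)) := by
    intro t
    have := pi_tail (rate ε d T) (rate_pos ε d T hε hd) {Sum.inr (Sum.inr t)} (ε / 12)
      (g3 ε β T) (β / (3 * T)) (by
        intro k hk
        rw [Finset.mem_singleton] at hk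
        subst hk
        simp only [rate]; linarith) 1 (by simp) (by positivity) (by
        refine le_of_eq ?_
        unfold g3
        rw [one_div_div]
        field_simp
        simp) (by positivity)
    simpa [noise] using this
  have hbad : noise ε d T {z | Good ε β d T z}ᶜ ≤ ENNReal.ofReal β := by
    have hsub : {z | Good ε β d T z}ᶜ ⊆
        (⋃ J : Fin (T+1), ⋃ i : Fin d, {z | g1 ε β d J < ∑ k ∈ nodes d T J i, |(z k : ℝ)|}) ∪
        ((⋃ J : Fin (T+1), {z : Idx d T → ℤ | g2 ε β J < |(z (Sum.inr (Sum.inl J)) : ℝ)|}) ∪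
        (⋃ t : Fin T, {z : Idx d T → ℤ | g3 ε β T < |(z (Sum.inr (Sum.inr t)) : ℝ)|})) := by
      intro z hz
      by_contra hcon
      apply hz
      simp only [Set.mem_union, Set.mem_iUnion, Set.mem_ofPred_eq, not_or, not_exists, not_lt] at hcon
      exact ⟨hcon.1, hcon.2.1, hcon.2.2⟩
    refine (measure_mono hsub).trans ?_
    refine (measure_union_le _ _).trans ((add_le_add le_rfl (measure_union_le _ _)).trans ?_)
    have s1 : noise ε d T (⋃ J : Fin (T+1), ⋃ i : Fin d,
        {z | g1 ε β d J < ∑ k ∈ nodes d T J i, |(z k : ℝ)|}) ≤ ENNReal.ofReal (β / 3) := by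
      refine (measure_iUnion_fintype_le _ _).trans ?_
      calc _ ≤ ∑ J : Fin (T+1), ∑ i : Fin d, ENNReal.ofReal (β / (3 * d) * w J) :=
            Finset.sum_le_sum fun J _ => (measure_iUnion_fintype_le _ _).trans
              (Finset.sum_le_sum fun i _ => t1 J i)
        _ = ENNReal.ofReal (∑ J : Fin (T+1), ∑ i : Fin d, (β / (3 * d) * w J)) := by
            rw [ENNReal.ofReal_sum_of_nonneg (fun J _ => Finset.sum_nonneg fun i _ => by
              have := hwpos J; positivity)]
            refine Finset.sum_congr rfl fun J _ => ?_
            rw [ENNReal.ofReal_sum_of_nonneg (fun i _ => by have := hwpos J; positivity)]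
        _ ≤ _ := by
            refine ENNReal.ofReal_le_ofReal ?_
            have : ∑ J : Fin (T+1), ∑ i : Fin d, (β / (3 * d) * w J) = β / 3 * ∑ J, w J := by
              rw [Finset.mul_sum]
              refine Finset.sum_congr rfl fun J _ => ?_
              simp only [Finset.sum_const, Finset.card_univ, Fintype.card_fin, nsmul_eq_mul]
              field_simp
            rw [this]
            nlinarith
    have s2 : noise ε d T (⋃ J : Fin (T+1),
        {z : Idx d T → ℤ | g2 ε β J < |(z (Sum.inr (Sum.inl J)) : ℝ)|}) ≤ ENNReal.ofReal (β / 3) := by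
      refine (measure_iUnion_fintype_le _ _).trans ((Finset.sum_le_sum fun J _ => t2 J).trans ?_)
      rw [← ENNReal.ofReal_sum_of_nonneg (fun J _ => by have := hwpos J; positivity),
        ← Finset.mul_sum]
      refine ENNReal.ofReal_le_ofReal ?_
      nlinarith
    have s3 : noise ε d T (⋃ t : Fin T,
        {z : Idx d T → ℤ | g3 ε β T < |(z (Sum.inr (Sum.inr t)) : ℝ)|}) ≤ ENNReal.ofReal (β / 3) := by
      refine (measure_iUnion_fintype_le _ _).trans ((Finset.sum_le_sum fun t _ => t3 t).trans ?_)
      rw [← ENNReal.ofReal_sum_of_nonneg (fun J _ => by positivity)]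
      refine ENNReal.ofReal_le_ofReal (le_of_eq ?_)
      simp only [Finset.sum_const, Finset.card_univ, Fintype.card_fin, nsmul_eq_mul]
      field_simp
    calc _ ≤ ENNReal.ofReal (β / 3) + (ENNReal.ofReal (β / 3) + ENNReal.ofReal (β / 3)) :=
          add_le_add s1 (add_le_add s2 s3)
      _ = ENNReal.ofReal β := by
          rw [← ENNReal.ofReal_add (by positivity) (by positivity),
            ← ENNReal.ofReal_add (by positivity) (by positivity)]
          congr 1; ring
  have hm : MeasurableSet {z | Good ε β d T z} := (Set.to_countable _).measurableSet
  have hcomp := prob_compl_eq_one_sub (μ := noise ε d T) hm.compl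
  rw [compl_compl] at hcomp
  rw [hcomp, ENNReal.ofReal_sub _ h0.le, ENNReal.ofReal_one]
  exact tsub_le_tsub_left hbad 1

theorem HH_eq_hist {d T : ℕ} (x : Fin T → Fin d → Bool) (t : Fin T) :
    quantile (1/2) (fun i => (hist x t i : ℝ)) = qz (HH x t.val) := by
  unfold qz
  congr 1
  funext i
  unfold hist HH
  push_cast
  refine Finset.sum_congr rfl fun s _ => ?_
  simp only [Fin.le_def]

theorem HH_step {d T : ℕ} (x : Fin T → Fin d → Bool) (t : ℕ) (i : Fin d) :
    HH x t i ≤ HH x (t+1) i ∧ HH x (t+1) i ≤ HH x t i + 1 := by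
  have key : HH x (t+1) i = HH x t i + ∑ s : Fin T, if s.val = t + 1 ∧ x s i then 1 else 0 := by
    unfold HH
    rw [← Finset.sum_add_distrib]
    refine Finset.sum_congr rfl fun s _ => ?_
    by_cases hx : x s i
    · simp only [hx, and_true]
      split_ifs <;> omega
    · simp [hx]
  have h1 : (0:ℤ) ≤ ∑ s : Fin T, if s.val = t + 1 ∧ x s i then 1 else 0 :=
    Finset.sum_nonneg fun s _ => by split_ifs <;> simp
  have h2 : (∑ s : Fin T, if s.val = t + 1 ∧ x s i then (1:ℤ) else 0) ≤ 1 := by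
    rw [← Finset.sum_filter, Finset.sum_const, nsmul_eq_mul, mul_one]
    have : (Finset.univ.filter fun s : Fin T => s.val = t + 1 ∧ x s i).card ≤ 1 := by
      refine Finset.card_le_one.2 fun a ha b hb => ?_
      simp only [Finset.mem_filter, Finset.mem_univ, true_and] at ha hb
      exact Fin.ext (by omega)
    exact_mod_cast this
  omega

theorem HH_zero {d T : ℕ} (x : Fin T → Fin d → Bool) (i : Fin d) :
    0 ≤ HH x 0 i ∧ HH x 0 i ≤ 1 := by
  unfold HH
  refine ⟨Finset.sum_nonneg fun s _ => by split_ifs <;> simp, ?_⟩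
  rw [← Finset.sum_filter, Finset.sum_const, nsmul_eq_mul, mul_one]
  have : (Finset.univ.filter fun s : Fin T => s.val ≤ 0 ∧ x s i).card ≤ 1 := by
    refine Finset.card_le_one.2 fun a ha b hb => ?_
    simp only [Finset.mem_filter, Finset.mem_univ, true_and] at ha hb
    exact Fin.ext (by omega)
  exact_mod_cast this

theorem qz_HH_mono {d T : ℕ} (hd : 1 ≤ d) (x : Fin T → Fin d → Bool) :
    Monotone (fun t => qz (HH x t)) := by
  refine monotone_nat_of_le_succ fun t => ?_
  have := qz_le_add hd (HH x t) (HH x (t+1)) 0 (fun i => by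
    rw [add_zero]; exact_mod_cast (HH_step x t i).1)
  linarith

theorem good_accurate (ε β : ℝ) (d T : ℕ) (hε : 0 < ε) (h0 : 0 < β) (h1 : β < 1) (hd : 1 ≤ d)
    (hT : 1 ≤ T) (x : Fin T → Fin d → Bool) (z : Idx d T → ℤ) (hz : Good ε β d T z) :
    ∀ t < T, (out (fun j => j + GG ε β d T j) x z (t+1) : ℝ) ≤ qz (HH x t) ∧
      qz (HH x t) ≤ out (fun j => j + GG ε β d T j) x z (t+1) +
        2 * GG ε β d T (out (fun j => j + GG ε β d T j) x z (t+1)) := by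
  refine traj_accurate hd T _ (GG ε β d T) (HH x) (zN z) (zmu z) (znu z)
    (GG_mono ε β d T hε h0 h1 hd) ?_ (fun _ => rfl) (fun i => (HH_zero x i).2)
    (fun i => (HH_zero x i).1) (fun t i => (HH_step x t i).1) (fun t i => (HH_step x t i).2) ?_
  · have := GG_parts_nonneg ε β d T hε h0 h1 hd hT 0
    unfold GG; linarith
  · intro t ht j hj
    obtain ⟨z1, z2, z3⟩ := hz
    have hj' : j < T + 1 := by omega
    have a1 : ∀ i, |(zN z j i : ℝ)| ≤ g1 ε β d j := fun i => (zN_le z j hj' i).trans (z1 ⟨j, hj'⟩ i)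
    have a2 : |(zmu z j : ℝ)| ≤ g2 ε β j := by
      unfold zmu; rw [dif_pos hj']; exact z2 ⟨j, hj'⟩
    have a3 : |(znu z t : ℝ)| ≤ g3 ε β T := by
      unfold znu; rw [dif_pos ht]; exact z3 ⟨t, ht⟩
    have b1 := qz_le_add hd (fun i => HH x t i + zN z j i) (HH x t) (g1 ε β d j) (fun i => by
      have := (abs_le.1 (a1 i)).2
      push_cast; linarith)
    have b2 := qz_le_add hd (HH x t) (fun i => HH x t i + zN z j i) (g1 ε β d j) (fun i => by
      have := (abs_le.1 (a1 i)).1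
      push_cast; linarith)
    rw [abs_le] at a2 a3 ⊢
    unfold GG
    constructor <;> linarith

theorem median_continual_observation :
    ∃ C : ℝ, 0 < C ∧
      ∀ (ε β : ℝ) (d T : ℕ) (_hε : 0 < ε) (_hβ : β ∈ Set.Ioo (0 : ℝ) 1)
        (_hd : 1 ≤ d) (hT : 1 ≤ T),
        ∃ M : (Fin T → Fin d → Bool) → Measure (Fin T → ℝ),
          IsCOMech M ∧ IsEventDP ε M ∧
          ∀ x, ENNReal.ofReal (1 - β) ≤
            M x {a | ∀ t : Fin T,
              |a t - quantile (1 / 2) (fun i => (hist x t i : ℝ))| ≤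
                C * ε⁻¹ * ((d : ℝ) *
                    (log2c ((d : ℝ) *
                      quantile (1 / 2) (fun i => (hist x (lastIdx T hT) i : ℝ)) / β)) ^ 2
                  + log2c (T : ℝ))} := by
  refine ⟨600, by norm_num, ?_⟩
  intro ε β d T hε hβ hd hT
  obtain ⟨h0, h1⟩ := hβ
  refine ⟨mech ε d T (fun j => j + GG ε β d T j), mech_isCO _ _ _ _ hε hd, mech_dp _ _ _ _ hε hd, ?_⟩
  intro x
  refine (good_prob ε β d T hε h0 h1 hd hT).trans ?_
  unfold mech
  refine le_trans (measure_mono ?_) (Measure.le_map_apply (measurable_of_countable _).aemeasurable _)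
  intro z hz t
  obtain ⟨a1, a2⟩ := good_accurate ε β d T hε h0 h1 hd hT x z hz t.val t.2
  simp only
  rw [HH_eq_hist, HH_eq_hist]
  set J := out (fun j => j + GG ε β d T j) x z (t.val + 1) with hJ
  have hmono : qz (HH x t.val) ≤ qz (HH x (lastIdx T hT).val) :=
    qz_HH_mono hd x (show t.val ≤ T - 1 by have := t.2; omega)
  obtain ⟨k, hk⟩ := qz_int hd (HH x (lastIdx T hT).val)
  have hJ0 : (0:ℝ) ≤ J := Nat.cast_nonneg _
  rw [abs_sub_comm, abs_of_nonneg (by linarith)]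
  rw [hk] at hmono ⊢
  rcases le_or_gt k 0 with hk0 | hk0
  · have : (k:ℝ) ≤ 0 := by exact_mod_cast hk0
    have hL : ∀ w, 0 ≤ log2c w := fun w => by
      rw [log2c]; exact Real.logb_nonneg (by norm_num) (le_trans (by norm_num) (le_max_right _ _))
    have r : 0 ≤ 600 * ε⁻¹ * ((d:ℝ) * (log2c ((d:ℝ) * k / β)) ^ 2 + log2c T) := by
      have := hL T
      positivity
    linarith
  · obtain ⟨n, rfl⟩ := Int.eq_ofNat_of_zero_le hk0.le
    have hn : 1 ≤ n := by omega
    have hJn : J ≤ n := by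
      have : (J:ℝ) ≤ n := by
        have e : (((n:ℤ)):ℝ) = n := by simp
        rw [e] at hmono
        linarith
      exact_mod_cast this
    have := GG_mono ε β d T hε h0 h1 hd hJn
    have b := GG_bound ε β d T hε h0 h1 hd hT n hn
    rw [Int.cast_natCast]
    linarith
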